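/- Let T be a tree chosen uniformly at random from the n^{n−2} labeled trees on vertex set {1,…,n} and let r₀ = ⌈7 ln n⌉. With high probability, for every vertex v of T: (i) the number of vertices of T within distance r₀ of v is at most 10^8 ln⁴ n; and (ii) fewer than ln n/(ln ln n)² of the vertices within distance r₀ of v have degree greater than (ln ln n)⁵. -/

import Mathlib

namespace FODef

open Classical in
/-- The probability of the event `E` for a tree chosen uniformly at random among all
labeled trees on the vertex set `Fin n`. -/
noncomputable def treeProb (n : ℕ) (E : Set (SimpleGraph (Fin n))) : ℝ :=
  ((Finset.univ.filter
      (fun T : SimpleGraph (Fin n) => T.Connected ∧ T.IsAcyclic ∧ T ∈ E)).card : ℝ) /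
  ((Finset.univ.filter
      (fun T : SimpleGraph (Fin n) => T.Connected ∧ T.IsAcyclic)).card : ℝ)

/-- Degree of a vertex. -/
noncomputable def deg {V : Type} (G : SimpleGraph V) (v : V) : ℕ :=
  Nat.card {w // G.Adj v w}

/-- `r₀ = ⌈7 ln n⌉`. -/
noncomputable def r0 (n : ℕ) : ℕ := ⌈(7 : ℝ) * Real.log n⌉₊

/-- `p` is adjacent to a vertex of degree one. -/
def adjToLeaf {V : Type} (T : SimpleGraph V) (p : V) : Prop :=
  ∃ w : V, T.Adj p w ∧ deg T w = 1

/-- The check of a path `P` from `v` to `w`: the sequence recording, for each vertex of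
`P` in order, whether it is adjacent to a vertex of degree one. -/
def check {V : Type} (T : SimpleGraph V) {v w : V} (P : T.Walk v w) : List Prop :=
  P.support.map fun p => adjToLeaf T p

end FODef

open Filter FODef

namespace FODef

section Weights

variable {V : Type*} [Fintype V] [DecidableEq V]

/-- The functions that map `A` into `B` and fix every point outside `A`. -/
def funsInto (A B : Finset V) : Finset (V → V) :=
  Fintype.piFinset fun w => if w ∈ A then B else {w}

lemma mem_funsInto {A B : Finset V} {f : V → V} :
    f ∈ funsInto A B ↔ (∀ w ∈ A, f w ∈ B) ∧ ∀ w ∉ A, f w = w := by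
  simp only [funsInto, Fintype.mem_piFinset]
  refine ⟨fun h => ⟨fun w hw => by simpa [hw] using h w, fun w hw => by simpa [hw] using h w⟩,
    fun h w => ?_⟩
  by_cases hw : w ∈ A
  · simpa [hw] using h.1 w hw
  · simpa [hw] using h.2 w hw

lemma sum_funsInto_prod (A B : Finset V) (y : V → ℝ) :
    ∑ f ∈ funsInto A B, ∏ w ∈ A, y (f w) = (∑ b ∈ B, y b) ^ A.card := by
  have h := Finset.prod_univ_sum (fun w => if w ∈ A then B else {w})
    (fun w b => if w ∈ A then y b else 1)
  have h1 : ∀ w, ∑ b ∈ (if w ∈ A then B else {w}), (if w ∈ A then y b else 1)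
      = if w ∈ A then ∑ b ∈ B, y b else 1 := by
    intro w; by_cases hw : w ∈ A <;> simp [hw]
  simp only [h1, Finset.prod_ite_mem, Finset.univ_inter, Finset.prod_const] at h
  exact h.symm

/-- The weight `∏ (1 + h * 2 ^ c u)` over the vertices `u` in the first `k` levels above `L` of the
map `f` on `A`, where `c u` is the number of preimages of `u` not in earlier levels. -/
noncomputable def levelWeight (h : ℝ) : ℕ → Finset V → Finset V → (V → V) → ℝ
  | 0, _, _, _ => 1
  | k + 1, A, L, f =>
    (∏ u ∈ L, (1 + h * 2 ^ (A.filter fun w => f w = u).card)) *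
      levelWeight h k (A \ A.filter fun w => f w ∈ L) (A.filter fun w => f w ∈ L) f

omit [Fintype V] in
lemma levelWeight_congr (h : ℝ) (k : ℕ) (A L : Finset V) {f g : V → V}
    (hfg : ∀ w ∈ A, f w = g w) : levelWeight h k A L f = levelWeight h k A L g := by
  induction k generalizing A L with
  | zero => rfl
  | succ k ih =>
    have h1 : ∀ p : V → Prop, ∀ [DecidablePred p],
        A.filter (fun w => p (f w)) = A.filter fun w => p (g w) := by
      intro p _
      exact Finset.filter_congr fun w hw => by rw [hfg w hw]
    simp only [levelWeight]
    rw [h1 (· ∈ L), ih _ _ fun w hw => hfg w (Finset.mem_sdiff.1 hw).1]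
    congr 1
    exact Finset.prod_congr rfl fun u _ => by rw [h1 (· = u)]

omit [Fintype V] in
lemma levelWeight_nonneg {h : ℝ} (hh : 0 ≤ h) (k : ℕ) (A L : Finset V) (f : V → V) :
    0 ≤ levelWeight h k A L f := by
  induction k generalizing A L with
  | zero => exact zero_le_one
  | succ k ih => exact mul_nonneg (Finset.prod_nonneg fun u _ => by positivity) (ih _ _)

lemma sum_fiber_eq (A B L S : Finset V) (hS : S ⊆ A) (hL : L ⊆ B) (P Q : (V → V) → ℝ)
    (hP : ∀ f g : V → V, (∀ w ∈ S, f w = g w) → P f = P g)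
    (hQ : ∀ f g : V → V, (∀ w ∈ A \ S, f w = g w) → Q f = Q g) :
    ∑ f ∈ (funsInto A B).filter (fun f => A.filter (fun w => f w ∈ L) = S), P f * Q f =
      (∑ f ∈ funsInto S L, P f) * ∑ f ∈ funsInto (A \ S) (B \ L), Q f := by
  rw [Finset.sum_mul_sum, ← Finset.sum_product']
  refine Finset.sum_nbij' (fun f => (S.piecewise f id, (A \ S).piecewise f id))
    (fun q => S.piecewise q.1 q.2) ?_ ?_ ?_ ?_ ?_
  · intro f hf
    rw [Finset.mem_filter, mem_funsInto] at hf
    obtain ⟨⟨h1, h2⟩, h3⟩ := hf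
    have h4 : ∀ w, w ∈ S ↔ w ∈ A ∧ f w ∈ L := fun w => by rw [← h3, Finset.mem_filter]
    rw [Finset.mem_product, mem_funsInto, mem_funsInto]
    refine ⟨⟨fun w hw => ?_, fun w hw => ?_⟩, fun w hw => ?_, fun w hw => ?_⟩
    · simpa [hw] using ((h4 w).1 hw).2
    · simp [hw]
    · have hw' := Finset.mem_sdiff.1 hw
      dsimp only
      rw [Finset.piecewise_eq_of_mem _ _ _ hw, Finset.mem_sdiff]
      exact ⟨h1 w hw'.1, fun h => hw'.2 ((h4 w).2 ⟨hw'.1, h⟩)⟩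
    · exact Finset.piecewise_eq_of_notMem _ _ _ hw
  · intro q hq
    rw [Finset.mem_product, mem_funsInto, mem_funsInto] at hq
    obtain ⟨⟨h1, h2⟩, h3, h4⟩ := hq
    rw [Finset.mem_filter, mem_funsInto]
    refine ⟨⟨fun w hw => ?_, fun w hw => ?_⟩, ?_⟩
    · by_cases hs : w ∈ S
      · simpa [hs] using hL (h1 w hs)
      · simpa [hs] using (Finset.mem_sdiff.1 (h3 w (Finset.mem_sdiff.2 ⟨hw, hs⟩))).1
    · have hs : w ∉ S := fun h => hw (hS h)
      simpa [hs] using h4 w (fun h => hw (Finset.mem_sdiff.1 h).1)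
    · ext w
      rw [Finset.mem_filter]
      by_cases hs : w ∈ S
      · simp [hs, hS hs, h1 w hs]
      · simp only [hs, not_false_eq_true, Finset.piecewise_eq_of_notMem, iff_false, not_and]
        exact fun hw => (Finset.mem_sdiff.1 (h3 w (Finset.mem_sdiff.2 ⟨hw, hs⟩))).2
  · intro f hf
    rw [Finset.mem_filter, mem_funsInto] at hf
    ext w
    by_cases hs : w ∈ S
    · simp [hs]
    · by_cases hw : w ∈ A
      · simp [hs, hw]
      · simp [hs, hw, hf.1.2 w hw]
  · intro q hq
    rw [Finset.mem_product, mem_funsInto, mem_funsInto] at hq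
    obtain ⟨⟨h1, h2⟩, h3, h4⟩ := hq
    refine Prod.ext (funext fun w => ?_) (funext fun w => ?_)
    · by_cases hs : w ∈ S
      · simp [hs]
      · simp [hs, h2 w hs]
    · by_cases hw : w ∈ A \ S
      · simp [(Finset.mem_sdiff.1 hw).2, (Finset.mem_sdiff.1 hw).1]
      · simp only [hw, not_false_eq_true, Finset.piecewise_eq_of_notMem, id]
        exact (h4 w hw).symm
  · intro f _
    rw [hP (S.piecewise f id) f fun w hw => by simp [hw],
      hQ ((A \ S).piecewise f id) f fun w hw => Finset.piecewise_eq_of_mem _ _ _ hw]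

lemma add_pow_le_pow_mul_exp {a b : ℕ} (hab : a ≤ b) {t : ℝ} (ht : 0 ≤ t) :
    ((b : ℝ) + t) ^ a ≤ (b : ℝ) ^ a * Real.exp t := by
  rcases Nat.eq_zero_or_pos b with rfl | hb
  · obtain rfl : a = 0 := by omega
    simpa using ht
  have hb' : (0 : ℝ) < b := by exact_mod_cast hb
  have h1 : (b : ℝ) + t = b * (1 + t / b) := by field_simp
  rw [h1, mul_pow]
  refine mul_le_mul_of_nonneg_left ?_ (by positivity)
  calc (1 + t / b) ^ a ≤ (1 + t / b) ^ b :=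
        pow_le_pow_right₀ (le_add_of_nonneg_right (by positivity)) hab
    _ ≤ Real.exp (t / b) ^ b := by
        gcongr; rw [add_comm]; exact Real.add_one_le_exp _
    _ = Real.exp t := by rw [← Real.exp_nat_mul]; congr 1; field_simp

lemma sum_funsInto_prod_degree (h : ℝ) (S L : Finset V) :
    ∑ f ∈ funsInto S L, ∏ u ∈ L, (1 + h * 2 ^ (S.filter fun w => f w = u).card) =
      ∑ U ∈ L.powerset, h ^ U.card * ((L.card : ℝ) + U.card) ^ S.card := by
  simp only [Finset.prod_one_add]
  rw [Finset.sum_comm]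
  refine Finset.sum_congr rfl fun U hU => ?_
  have hU := Finset.mem_powerset.1 hU
  have h1 : ∀ f : V → V, ∏ u ∈ U, h * 2 ^ (S.filter fun w => f w = u).card =
      h ^ U.card * ∏ w ∈ S, (if f w ∈ U then (2 : ℝ) else 1) := by
    intro f
    rw [Finset.prod_mul_distrib, Finset.prod_const]
    congr 1
    rw [Finset.prod_pow_eq_pow_sum, Finset.prod_ite, Finset.prod_const, Finset.prod_const_one,
      mul_one]
    congr 1
    rw [Finset.card_eq_sum_card_fiberwise (f := f) (t := U) (by intro w; simp)]
    refine Finset.sum_congr rfl fun u hu => ?_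
    congr 1
    ext w
    simp only [Finset.mem_filter]
    constructor
    · rintro ⟨a, rfl⟩; exact ⟨⟨a, hu⟩, rfl⟩
    · rintro ⟨⟨a, -⟩, b⟩; exact ⟨a, b⟩
  simp only [h1]
  rw [← Finset.mul_sum, sum_funsInto_prod S L fun b => if b ∈ U then 2 else 1]
  congr 2
  have h2 : ∀ b, (if b ∈ U then (2 : ℝ) else 1) = 1 + if b ∈ U then 1 else 0 := by
    intro b; split_ifs <;> norm_num
  simp only [h2, Finset.sum_add_distrib, Finset.sum_ite_mem, Finset.inter_eq_right.2 hU]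
  simp

/-- The growth of the expected level weight over one generation. -/
noncomputable def growth (h : ℝ) : ℕ → ℝ
  | 0 => 1
  | k + 1 => Real.exp (growth h k - 1) * (1 + h * Real.exp (growth h k))

lemma one_le_growth {h : ℝ} (hh : 0 ≤ h) (k : ℕ) : 1 ≤ growth h k := by
  induction k with
  | zero => exact le_rfl
  | succ k ih =>
    rw [growth]
    exact one_le_mul_of_one_le_of_one_le (Real.one_le_exp (by linarith))
      (le_add_of_nonneg_right (by positivity))

omit [Fintype V] [DecidableEq V] in
lemma sum_powerset_pow_le {h Y : ℝ} (hh : 0 ≤ h) (hY : 1 ≤ Y) {a b : ℕ} (hab : a ≤ b)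
    (L : Finset V) :
    ∑ U ∈ L.powerset, h ^ U.card * (((L.card : ℝ) + U.card) * Y + (b - L.card)) ^ a ≤
      (b : ℝ) ^ a * (Real.exp (Y - 1) * (1 + h * Real.exp Y)) ^ L.card := by
  calc _ ≤ ∑ U ∈ L.powerset, h ^ U.card * ((b : ℝ) ^ a *
            (Real.exp (Y - 1) ^ L.card * Real.exp Y ^ U.card)) := by
        refine Finset.sum_le_sum fun U _ => mul_le_mul_of_nonneg_left ?_ (by positivity)
        have ht : (0 : ℝ) ≤ L.card * (Y - 1) + U.card * Y := by
          have : 0 ≤ Y - 1 := by linarith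
          positivity
        have h1 := add_pow_le_pow_mul_exp hab ht
        rw [Real.exp_add, Real.exp_nat_mul, Real.exp_nat_mul] at h1
        refine le_of_eq_of_le ?_ h1
        congr 1
        ring
    _ = (b : ℝ) ^ a * (Real.exp (Y - 1) ^ L.card *
          ∑ U ∈ L.powerset, ∏ u ∈ U, (h * Real.exp Y)) := by
        rw [Finset.mul_sum, Finset.mul_sum]
        refine Finset.sum_congr rfl fun U _ => ?_
        rw [Finset.prod_const, mul_pow]
        ring
    _ = _ := by
        rw [← Finset.prod_one_add, Finset.prod_const, ← mul_pow]

lemma sum_levelWeight_le {h : ℝ} (hh : 0 ≤ h) (k : ℕ) (A B L : Finset V) (hA : A ⊆ B) (hL : L ⊆ B)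
    (hAL : Disjoint A L) :
    ∑ f ∈ funsInto A B, levelWeight h k A L f ≤ (B.card : ℝ) ^ A.card * growth h k ^ L.card := by
  induction k generalizing A B L with
  | zero =>
    have := sum_funsInto_prod A B fun _ => 1
    simp only [levelWeight, growth, one_pow, mul_one]
    simpa using this.le
  | succ k ih =>
    set Y := growth h k
    have hY1 : 1 ≤ Y := one_le_growth hh k
    have hmap : ∀ f ∈ funsInto A B, A.filter (fun w => f w ∈ L) ∈ A.powerset :=
      fun f _ => Finset.mem_powerset.2 (Finset.filter_subset _ _)
    rw [← Finset.sum_fiberwise_of_maps_to hmap]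
    have hcard : ((B \ L).card : ℝ) = B.card - L.card := by
      rw [Finset.card_sdiff_of_subset hL, Nat.cast_sub (Finset.card_le_card hL)]
    have hAB : A.card ≤ B.card := Finset.card_le_card hA
    have step : ∀ S ∈ A.powerset,
        ∑ f ∈ (funsInto A B).filter (fun f => A.filter (fun w => f w ∈ L) = S),
          levelWeight h (k + 1) A L f ≤
        ∑ U ∈ L.powerset, h ^ U.card * ((((L.card : ℝ) + U.card) * Y) ^ S.card *
          ((B.card : ℝ) - L.card) ^ (A.card - S.card)) := by
      intro S hS
      have hS := Finset.mem_powerset.1 hS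
      calc _ = ∑ f ∈ (funsInto A B).filter (fun f => A.filter (fun w => f w ∈ L) = S),
              (∏ u ∈ L, (1 + h * 2 ^ (S.filter fun w => f w = u).card)) *
                levelWeight h k (A \ S) S f := by
            refine Finset.sum_congr rfl fun f hf => ?_
            have hf := (Finset.mem_filter.1 hf).2
            rw [levelWeight, hf]
            congr 1
            refine Finset.prod_congr rfl fun u hu => ?_
            rw [show A.filter (fun w => f w = u) = S.filter fun w => f w = u from ?_]
            rw [← hf, Finset.filter_filter]
            exact Finset.filter_congr fun w _ => ⟨fun h => ⟨h ▸ hu, h⟩, fun h => h.2⟩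
        _ = (∑ f ∈ funsInto S L, ∏ u ∈ L, (1 + h * 2 ^ (S.filter fun w => f w = u).card)) *
              ∑ f ∈ funsInto (A \ S) (B \ L), levelWeight h k (A \ S) S f := by
            refine sum_fiber_eq A B L S hS hL _ _ (fun f g hfg => ?_) fun f g hfg =>
              levelWeight_congr h k _ _ hfg
            refine Finset.prod_congr rfl fun u _ => ?_
            rw [Finset.filter_congr fun w hw => by rw [hfg w hw]]
        _ ≤ (∑ U ∈ L.powerset, h ^ U.card * ((L.card : ℝ) + U.card) ^ S.card) *
              (((B.card : ℝ) - L.card) ^ (A.card - S.card) * Y ^ S.card) := by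
            rw [sum_funsInto_prod_degree]
            refine mul_le_mul_of_nonneg_left ?_ (Finset.sum_nonneg fun U _ => by positivity)
            have := ih (A \ S) (B \ L) S
              (fun w hw => by
                have hw := Finset.mem_sdiff.1 hw
                exact Finset.mem_sdiff.2 ⟨hA hw.1, Finset.disjoint_left.1 hAL hw.1⟩)
              (fun w hw => Finset.mem_sdiff.2 ⟨hA (hS hw), Finset.disjoint_left.1 hAL (hS hw)⟩)
              Finset.sdiff_disjoint
            rwa [hcard, Finset.card_sdiff_of_subset hS] at this
        _ = _ := by
            rw [Finset.sum_mul]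
            refine Finset.sum_congr rfl fun U _ => ?_
            rw [mul_pow]; ring
    refine (Finset.sum_le_sum step).trans ?_
    rw [Finset.sum_comm]
    simp only [← Finset.mul_sum, Finset.sum_pow_mul_eq_add_pow]
    exact sum_powerset_pow_le hh hY1 hAB L

lemma growth_le {R : ℕ} (hR : 0 < R) {k : ℕ} (hk : k ≤ R) :
    growth (1 / (84 * (R : ℝ) ^ 2)) k ≤ 2 := by
  have hR' : (1 : ℝ) ≤ R := by exact_mod_cast hR
  set h : ℝ := 1 / (84 * (R : ℝ) ^ 2) with hh
  have hpos : 0 < h := by positivity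
  have hhR : h * R ^ 2 = 1 / 84 := by rw [hh]; field_simp
  have key : ∀ j ≤ R, growth h j - 1 ≤ 42 * h * j := by
    intro j hj
    induction j with
    | zero => simp [growth]
    | succ j ih =>
      have ih := ih (by omega)
      have hj' : (j : ℝ) ≤ R := by exact_mod_cast (by omega : j ≤ R)
      have h1 : h * j ≤ 1 / 84 := by
        nlinarith [mul_le_mul_of_nonneg_left hR' (by positivity : 0 ≤ h * R),
          mul_le_mul_of_nonneg_left hj' hpos.le]
      have h2 : h * (j : ℝ) ^ 2 ≤ 1 / 84 := by
        rw [← hhR]; gcongr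
      set y := growth h j - 1 with hy
      have hy0 : 0 ≤ y := by have := one_le_growth hpos.le j; linarith
      have hy1 : y ≤ 1 / 2 := by nlinarith
      have he : Real.exp y ≤ 1 + y + y ^ 2 := by
        have := Real.abs_exp_sub_one_sub_id_le (x := y) (by rw [abs_of_nonneg hy0]; linarith)
        have := abs_le.1 this
        linarith [this.2]
      have hE : Real.exp y * Real.exp (1 + y) ≤ 21 := by
        rw [← Real.exp_add]
        have h3 : Real.exp (y + (1 + y)) ≤ Real.exp 1 ^ 3 := by
          rw [← Real.exp_nat_mul]
          exact Real.exp_le_exp.2 (by push_cast; linarith)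
        have h4 := Real.exp_one_lt_d9
        have h5 : Real.exp 1 ^ 3 ≤ 2.7182818286 ^ 3 := by gcongr
        exact (h3.trans h5).trans (by norm_num)
      have hg : growth h (j + 1) = Real.exp y + h * (Real.exp y * Real.exp (1 + y)) := by
        rw [growth, show growth h j = 1 + y by rw [hy]; ring]
        ring_nf
      rw [hg]
      push_cast
      have h6 : y ^ 2 ≤ (42 * h * j) ^ 2 := by gcongr
      have h7 : (42 * h * j) ^ 2 ≤ 21 * h := by
        have : (42 * h * j) ^ 2 = 1764 * h * (h * (j : ℝ) ^ 2) := by ring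
        rw [this]
        nlinarith
      nlinarith [mul_le_mul_of_nonneg_left hE hpos.le]
  have h1 := key k hk
  have hk' : (k : ℝ) ≤ R := by exact_mod_cast hk
  have h2 : h * k ≤ 1 / 84 := by
    nlinarith [mul_le_mul_of_nonneg_left hR' (by positivity : 0 ≤ h * R),
      mul_le_mul_of_nonneg_left hk' hpos.le]
  linarith

end Weights

section Forests

variable {V : Type*}

/-- `f` is the parent map of a rooted forest whose roots are the fixed points of `f`: there are a
rank `d` that decreases from a vertex to its parent, and a map `ρ` to the root of the component. -/
def IsForestMap (f : V → V) (d : V → ℕ) (ρ : V → V) : Prop :=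
  (∀ w, f w ≠ w → d (f w) < d w) ∧ (∀ w, f (ρ w) = ρ w) ∧ (∀ w, ρ (f w) = ρ w) ∧
    ∀ w, f w = w → ρ w = w

/-- The graph joining every vertex to its image under `f`. -/
def mapGraph (f : V → V) : SimpleGraph V := SimpleGraph.fromRel fun x y => f x = y

lemma mapGraph_adj {f : V → V} {x y : V} :
    (mapGraph f).Adj x y ↔ x ≠ y ∧ (f x = y ∨ f y = x) := SimpleGraph.fromRel_adj _ _ _

lemma mapGraph_reachable (f : V → V) (w : V) : (mapGraph f).Reachable w (f w) := by
  by_cases h : w = f w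
  · rw [← h]
  · exact (mapGraph_adj.2 ⟨h, Or.inl rfl⟩ : (mapGraph f).Adj w (f w)).reachable

lemma mapGraph_connected {f : V → V} {d : V → ℕ} {v : V}
    (hd : ∀ w, w ≠ v → d (f w) < d w) : (mapGraph f).Connected := by
  have key : ∀ m, ∀ w, d w = m → (mapGraph f).Reachable w v := by
    intro m
    induction m using Nat.strong_induction_on with
    | _ m ih =>
      intro w hw
      by_cases h : w = v
      · rw [h]
      · exact (mapGraph_reachable f w).trans (ih _ (hw ▸ hd w h) _ rfl)
  have : Nonempty V := ⟨v⟩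
  exact ⟨fun x y => (key _ x rfl).trans (key _ y rfl).symm⟩

lemma mapGraph_isTree [Fintype V] {f : V → V} {d : V → ℕ} {v : V}
    (hv : f v = v) (hd : ∀ w, w ≠ v → d (f w) < d w) : (mapGraph f).IsTree := by
  classical
  rw [SimpleGraph.isTree_iff_connected_and_card]
  have hc := mapGraph_connected hd
  refine ⟨hc, le_antisymm ?_ hc.card_vert_le_card_edgeSet_add_one⟩
  have h1 : (mapGraph f).edgeSet ⊆
      ((Finset.univ.erase v).image fun w => s(w, f w) : Finset (Sym2 V)) := by
    intro e
    induction e with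
    | _ x y =>
      intro he
      obtain ⟨hne, h | h⟩ := mapGraph_adj.1 (SimpleGraph.mem_edgeSet _ |>.1 he)
      · subst h
        refine Finset.mem_coe.2 (Finset.mem_image.2 ⟨x, ?_, rfl⟩)
        simp only [Finset.mem_erase, Finset.mem_univ, and_true]
        rintro rfl; exact hne hv.symm
      · subst h
        refine Finset.mem_coe.2 (Finset.mem_image.2 ⟨y, ?_, Sym2.eq_swap⟩)
        simp only [Finset.mem_erase, Finset.mem_univ, and_true]
        rintro rfl; exact hne hv
  have h2 := Nat.card_mono (Finset.finite_toSet _) h1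
  have h3 := Finset.card_image_le (s := Finset.univ.erase v) (f := fun w => s(w, f w))
  rw [Nat.card_coe_set_eq, Nat.card_coe_set_eq, Set.ncard_coe_finset] at h2
  rw [Finset.card_erase_of_mem (Finset.mem_univ v), Finset.card_univ] at h3
  have h4 : 0 < Fintype.card V := Fintype.card_pos_iff.2 ⟨v⟩
  rw [Nat.card_coe_set_eq, Nat.card_eq_fintype_card]
  omega

lemma eq_of_mapGraph_eq {f g : V → V} {d e : V → ℕ} {v : V} (hf : f v = v) (hg : g v = v)
    (hd : ∀ w, w ≠ v → d (f w) < d w) (he : ∀ w, w ≠ v → e (g w) < e w)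
    (hfg : mapGraph f = mapGraph g) : f = g := by
  have key : ∀ m, ∀ w, e w = m → f w = g w := by
    intro m
    induction m using Nat.strong_induction_on with
    | _ m ih =>
      intro w hw
      by_contra hne
      have hwv : w ≠ v := by rintro rfl; exact hne (hf.trans hg.symm)
      have hew := he w hwv
      have hgw : g w ≠ w := fun h => by rw [h] at hew; exact lt_irrefl _ hew
      have hadj : (mapGraph f).Adj w (g w) := by
        rw [hfg]; exact mapGraph_adj.2 ⟨hgw.symm, Or.inl rfl⟩
      have h1 : f (g w) = w := ((mapGraph_adj.1 hadj).2.resolve_left hne)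
      have h2 : g (g w) = w := (ih _ (hw ▸ hew) _ rfl).symm.trans h1
      have h3 : g w ≠ v := by intro h; rw [h, hf] at h1; exact hwv h1.symm
      have h4 := he _ h3
      rw [h2] at h4
      omega
  exact funext fun w => key _ w rfl

variable [Fintype V] [DecidableEq V]

open Classical in
/-- The parent maps of rooted forests with exactly `k` edges. -/
noncomputable def forestMaps (V : Type*) [Fintype V] [DecidableEq V] (k : ℕ) : Finset (V → V) :=
  Finset.univ.filter fun f =>
    (∃ d ρ, IsForestMap f d ρ) ∧ (Finset.univ.filter fun w => f w ≠ w).card = k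

lemma mem_forestMaps {k : ℕ} {f : V → V} : f ∈ forestMaps V k ↔
    (∃ d ρ, IsForestMap f d ρ) ∧ (Finset.univ.filter fun w => f w ≠ w).card = k := by
  simp [forestMaps]

omit [Fintype V] in
lemma IsForestMap.update {f : V → V} {d : V → ℕ} {ρ : V → V} (h : IsForestMap f d ρ) {x y : V}
    (hx : f x = x) (hy : ρ y ≠ x) :
    ∃ d' ρ', IsForestMap (Function.update f x y) d' ρ' := by
  obtain ⟨h1, h2, h3, h4⟩ := h
  have hρx : ρ x = x := h4 x hx
  have hyx : y ≠ x := by rintro rfl; exact hy hρx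
  refine ⟨fun w => d w + if ρ w = x then d y + 1 else 0, fun w => if ρ w = x then ρ y else ρ w,
    fun w hw => ?_, fun w => ?_, fun w => ?_, fun w hw => ?_⟩
  · by_cases hwx : w = x
    · subst hwx
      simp only [Function.update_self, hy, hρx, if_true, if_false]
      omega
    · simp only [Function.update_of_ne hwx] at hw ⊢
      rw [h3 w]
      exact Nat.add_lt_add_right (h1 w hw) _
  · have h5 : (if ρ w = x then ρ y else ρ w) ≠ x := by split_ifs with h <;> assumption
    simp only [Function.update_of_ne h5]
    split_ifs <;> exact h2 _
  · by_cases hwx : w = x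
    · subst hwx
      simp [hy, hρx]
    · simp only [Function.update_of_ne hwx, h3]
  · by_cases hwx : w = x
    · subst hwx
      simp only [Function.update_self] at hw
      exact absurd hw hyx
    · simp only [Function.update_of_ne hwx] at hw
      simp [h4 w hw, hwx]

lemma card_forestMaps_mul_le (k : ℕ) :
    (forestMaps V k).card * (Fintype.card V * (Fintype.card V - 1 - k)) ≤
      (forestMaps V (k + 1)).card * (k + 1) := by
  classical
  have hex : ∀ f : V → V, ∃ ρ : V → V, f ∈ forestMaps V k → ∃ d, IsForestMap f d ρ := by
    intro f
    by_cases hf : f ∈ forestMaps V k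
    · obtain ⟨⟨d, ρ, h⟩, -⟩ := mem_forestMaps.1 hf
      exact ⟨ρ, fun _ => ⟨d, h⟩⟩
    · exact ⟨id, fun h => absurd h hf⟩
  choose ρ hρ using hex
  set S := (forestMaps V k).sigma fun f =>
    (Finset.univ : Finset V).sigma fun y =>
      (Finset.univ.filter fun x => f x = x).erase (ρ f y) with hS
  set S' := (forestMaps V (k + 1)).sigma fun f => Finset.univ.filter fun x => f x ≠ x with hS'
  have hc : S.card = (forestMaps V k).card * (Fintype.card V * (Fintype.card V - 1 - k)) := by
    rw [hS, Finset.card_sigma, Finset.sum_const_nat]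
    intro f hf
    rw [Finset.card_sigma, Finset.sum_const_nat, Finset.card_univ]
    intro y _
    obtain ⟨d, -, h2, -, -⟩ := hρ f hf
    have hk := (mem_forestMaps.1 hf).2
    rw [Finset.card_erase_of_mem (by simp [h2])]
    have := Finset.card_filter_add_card_filter_not (s := (Finset.univ : Finset V)) fun x => f x = x
    rw [Finset.card_univ] at this
    simp only [ne_eq] at hk
    omega
  have hc' : S'.card = (forestMaps V (k + 1)).card * (k + 1) := by
    rw [hS', Finset.card_sigma, Finset.sum_const_nat]
    exact fun f hf => (mem_forestMaps.1 hf).2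
  rw [← hc, ← hc']
  refine Finset.card_le_card_of_injOn
    (fun q => ⟨Function.update q.1 q.2.2 q.2.1, q.2.2⟩) ?_ ?_
  · rintro ⟨f, y, x⟩ hq
    simp only [hS, Finset.coe_sigma, Set.mem_sigma_iff, Finset.mem_coe, Finset.mem_erase,
      Finset.mem_filter, Finset.mem_univ, true_and] at hq
    obtain ⟨hf, hyx, hx⟩ := hq
    obtain ⟨d, h⟩ := hρ f hf
    have hxy : y ≠ x := by rintro rfl; exact hyx (h.2.2.2 y hx).symm
    simp only [hS', Finset.coe_sigma, Set.mem_sigma_iff, Finset.mem_coe,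
      Finset.mem_filter, Finset.mem_univ, true_and, Function.update_self]
    refine ⟨mem_forestMaps.2 ⟨h.update hx (Ne.symm hyx), ?_⟩, hxy⟩
    have h1 : (Finset.univ.filter fun w => Function.update f x y w ≠ w) =
        insert x (Finset.univ.filter fun w => f w ≠ w) := by
      ext w
      by_cases hw : w = x
      · subst hw; simp [hxy]
      · simp [hw]
    rw [h1, Finset.card_insert_of_notMem (by simp [hx]), (mem_forestMaps.1 hf).2]
  · rintro ⟨f, y, x⟩ hq ⟨f', y', x'⟩ hq' heq
    simp only [hS, Finset.coe_sigma, Set.mem_sigma_iff, Finset.mem_coe, Finset.mem_erase,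
      Finset.mem_filter, Finset.mem_univ, true_and] at hq hq'
    simp only [Sigma.mk.injEq, heq_eq_eq] at heq
    obtain ⟨h1, rfl⟩ := heq
    have hy : y = y' := by simpa using congrFun h1 x
    have hf : f = f' := by
      funext w
      by_cases hw : w = x
      · subst hw; rw [hq.2.2, hq'.2.2]
      · simpa [hw] using congrFun h1 w
    subst hy hf
    rfl

lemma pow_mul_choose_le_card_forestMaps (k : ℕ) :
    Fintype.card V ^ k * (Fintype.card V - 1).choose k ≤ (forestMaps V k).card := by
  induction k with
  | zero =>
    simp only [pow_zero, Nat.choose_zero_right, mul_one, Nat.one_le_iff_ne_zero, ne_eq,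
      Finset.card_eq_zero]
    refine Finset.ne_empty_of_mem (a := id) (mem_forestMaps.2 ⟨⟨fun _ => 0, id, ?_⟩, by simp⟩)
    exact ⟨fun w h => absurd rfl h, fun _ => rfl, fun _ => rfl, fun _ _ => rfl⟩
  | succ k ih =>
    refine Nat.le_of_mul_le_mul_right ?_ (Nat.succ_pos k)
    refine le_trans (le_of_eq ?_) ((Nat.mul_le_mul_right _ ih).trans (card_forestMaps_mul_le k))
    rw [mul_assoc, Nat.choose_succ_right_eq]
    ring

open Classical in
lemma pow_card_sub_one_le_card_trees [Nonempty V] :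
    Fintype.card V ^ (Fintype.card V - 1) ≤
      (Finset.univ.filter fun T : SimpleGraph V => T.Connected ∧ T.IsAcyclic).card *
        Fintype.card V := by
  have h := pow_mul_choose_le_card_forestMaps (V := V) (Fintype.card V - 1)
  rw [Nat.choose_self, mul_one] at h
  refine h.trans ?_
  have hroot : ∀ f : V → V, ∃ v, f ∈ forestMaps V (Fintype.card V - 1) →
      f v = v ∧ ∃ d : V → ℕ, ∀ w, w ≠ v → d (f w) < d w := by
    intro f
    by_cases hf : f ∈ forestMaps V (Fintype.card V - 1)
    · obtain ⟨⟨d, ρ, h⟩, hk⟩ := mem_forestMaps.1 hf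
      have h1 := Finset.card_filter_add_card_filter_not (s := (Finset.univ : Finset V))
        fun x => f x = x
      have h0 : 0 < Fintype.card V := Fintype.card_pos
      rw [Finset.card_univ] at h1
      simp only [ne_eq] at hk
      obtain ⟨v, hv⟩ := Finset.card_eq_one.1
        (by omega : (Finset.univ.filter fun x => f x = x).card = 1)
      have hv' : ∀ w, f w = w ↔ w = v := fun w => by
        simpa using Finset.ext_iff.1 hv w
      exact ⟨v, fun _ => ⟨(hv' v).2 rfl, d, fun w hw => h.1 w fun h => hw ((hv' w).1 h)⟩⟩
    · exact ⟨Classical.arbitrary V, fun h => absurd h hf⟩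
  choose r hr using hroot
  rw [← Finset.card_univ (α := V), ← Finset.card_product]
  refine Finset.card_le_card_of_injOn (fun f => (mapGraph f, r f)) ?_ ?_
  · intro f hf
    obtain ⟨h1, d, h2⟩ := hr f hf
    have := mapGraph_isTree h1 h2
    simp [this.1, this.2]
  · intro f hf g hg hfg
    obtain ⟨h1, d, h2⟩ := hr f hf
    obtain ⟨h3, e, h4⟩ := hr g hg
    obtain ⟨h5, h6⟩ := Prod.mk.inj hfg
    rw [h6] at h1 h2
    exact eq_of_mapGraph_eq h1 h3 h2 h4 h5

end Forests

section Trees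

variable {V : Type} [Fintype V] [DecidableEq V]

omit [Fintype V] [DecidableEq V] in
lemma exists_adj_dist_eq {T : SimpleGraph V} (hT : T.Connected) {v w : V} (hw : w ≠ v) :
    ∃ u, T.Adj w u ∧ T.dist v w = T.dist v u + 1 := by
  obtain ⟨p, hp⟩ := hT.exists_walk_length_eq_dist w v
  cases p with
  | nil => exact absurd rfl hw
  | @cons _ u _ h q =>
    refine ⟨u, h, ?_⟩
    have h1 := T.dist_le q
    have h2 := hT.dist_triangle (u := w) (v := u) (w := v)
    rw [SimpleGraph.dist_eq_one_iff_adj.2 h] at h2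
    rw [SimpleGraph.Walk.length_cons] at hp
    rw [T.dist_comm (u := v) (v := w), T.dist_comm (u := v) (v := u)]
    omega

/-- `p` is the parent map of the tree `T` rooted at `v`. -/
def IsParentMap (T : SimpleGraph V) (v : V) (p : V → V) : Prop :=
  mapGraph p = T ∧ p v = v ∧ ∀ w, w ≠ v → T.dist v w = T.dist v (p w) + 1

omit [Fintype V] in
lemma exists_isParentMap {T : SimpleGraph V} (hT : T.IsTree) (v : V) : ∃ p, IsParentMap T v p := by
  have hex : ∀ w, ∃ u, (w = v → u = v) ∧ (w ≠ v → T.Adj w u ∧ T.dist v w = T.dist v u + 1) := by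
    intro w
    by_cases hw : w = v
    · exact ⟨v, fun _ => rfl, fun h => absurd hw h⟩
    · obtain ⟨u, hu⟩ := exists_adj_dist_eq hT.1 hw
      exact ⟨u, fun h => absurd h hw, fun _ => hu⟩
  choose p hp1 hp2 using hex
  have hpv := hp1 v rfl
  refine ⟨p, ?_, hpv, fun w hw => (hp2 w hw).2⟩
  have hc : (mapGraph p).Connected :=
    mapGraph_connected (d := T.dist v) (v := v) fun w hw => by rw [(hp2 w hw).2]; omega
  have hle : mapGraph p ≤ T := by
    intro x y hxy
    obtain ⟨hne, h | h⟩ := mapGraph_adj.1 hxy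
    · have hx : x ≠ v := by rintro rfl; exact hne (hpv.symm.trans h)
      exact h ▸ (hp2 x hx).1
    · have hy : y ≠ v := by rintro rfl; exact hne (h.symm.trans hpv)
      exact h ▸ (hp2 y hy).1.symm
  exact le_antisymm hle ((SimpleGraph.isTree_iff_minimal_connected.1 hT).2 hc hle)

lemma levelWeight_eq_prod (h : ℝ) {p : V → V} {d : V → ℕ} {v : V} (hv : d v = 0)
    (hd : ∀ w, w ≠ v → d w = d (p w) + 1) (k j : ℕ) :
    levelWeight h k (Finset.univ.filter fun w => j < d w) (Finset.univ.filter fun w => d w = j) p =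
      ∏ u with j ≤ d u ∧ d u < j + k,
        (1 + h * 2 ^ (Finset.univ.filter fun w => w ≠ v ∧ p w = u).card) := by
  induction k generalizing j with
  | zero =>
    simp only [levelWeight, add_zero]
    rw [Finset.filter_false_of_mem (fun u _ => by omega), Finset.prod_empty]
  | succ k ih =>
    have hne : ∀ w, 0 < d w → w ≠ v := by rintro w hw rfl; omega
    have h1 : (Finset.univ.filter fun w => j < d w).filter
        (fun w => p w ∈ Finset.univ.filter fun w => d w = j) =
        Finset.univ.filter fun w => d w = j + 1 := by
      ext w
      simp only [Finset.mem_filter, Finset.mem_univ, true_and]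
      constructor
      · rintro ⟨a, b⟩
        rw [hd w (hne w (by omega)), b]
      · intro a
        have := hd w (hne w (by omega))
        omega
    have h2 : (Finset.univ.filter fun w => j < d w) \ Finset.univ.filter (fun w => d w = j + 1) =
        Finset.univ.filter fun w => j + 1 < d w := by
      ext w
      simp only [Finset.mem_sdiff, Finset.mem_filter, Finset.mem_univ, true_and]
      omega
    have h3 : (Finset.univ.filter fun u => j ≤ d u ∧ d u < j + (k + 1)) =
        (Finset.univ.filter fun w => d w = j) ∪
          Finset.univ.filter fun u => j + 1 ≤ d u ∧ d u < j + 1 + k := by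
      ext w
      simp only [Finset.mem_union, Finset.mem_filter, Finset.mem_univ, true_and]
      omega
    rw [levelWeight, h1, h2, ih (j + 1), h3, Finset.prod_union]
    · congr 1
      refine Finset.prod_congr rfl fun u hu => ?_
      have hu := (Finset.mem_filter.1 hu).2
      rw [Finset.filter_filter]
      congr 4
      ext w
      simp only [Finset.mem_filter, Finset.mem_univ, true_and]
      refine ⟨fun ⟨a, b⟩ => ⟨hne w (by omega), b⟩, fun ⟨a, b⟩ => ⟨?_, b⟩⟩
      rw [hd w a, b]
      omega
    · rw [Finset.disjoint_left]
      intro w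
      simp only [Finset.mem_filter, Finset.mem_univ, true_and]
      omega

lemma IsParentMap.deg_sub_one_le {T : SimpleGraph V} {v : V} {p : V → V} (hp : IsParentMap T v p)
    (u : V) : deg T u - 1 ≤ (Finset.univ.filter fun w => w ≠ v ∧ p w = u).card := by
  obtain ⟨hT, hv, -⟩ := hp
  have h1 : {w | T.Adj u w} ⊆
      ((insert (p u) (Finset.univ.filter fun w => w ≠ v ∧ p w = u) : Finset V) : Set V) := by
    intro w hw
    rw [Set.mem_ofPred_eq, ← hT, mapGraph_adj] at hw
    obtain ⟨hne, h | h⟩ := hw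
    · simp [h]
    · have : w ≠ v := by rintro rfl; exact hne (h.symm.trans hv)
      simp [h, this]
  have h2 := Nat.card_mono (Finset.finite_toSet _) h1
  rw [Nat.card_coe_set_eq (SetLike.coe _), Set.ncard_coe_finset] at h2
  have h3 := Finset.card_insert_le (p u) (Finset.univ.filter fun w => w ≠ v ∧ p w = u)
  have h4 : deg T u = Nat.card {w | T.Adj u w} := rfl
  omega

/-- The weight `∏ (1 + h * 2 ^ (deg u - 1))` over the vertices `u` at distance less than `R`
from `v`. -/
noncomputable def ballWeight (h : ℝ) (R : ℕ) (T : SimpleGraph V) (v : V) : ℝ :=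
  ∏ u with T.dist v u < R, (1 + h * 2 ^ (deg T u - 1))

open Classical in
lemma sum_ballWeight_le {h : ℝ} (hh : 0 ≤ h) (R : ℕ) (v : V) :
    ∑ T : SimpleGraph V with T.Connected ∧ T.IsAcyclic, ballWeight h R T v ≤
      (Fintype.card V : ℝ) ^ (Fintype.card V - 1) * growth h R := by
  have hex : ∀ T : SimpleGraph V, ∃ p, T.IsTree → IsParentMap T v p := by
    intro T
    by_cases hT : T.IsTree
    · obtain ⟨p, hp⟩ := exists_isParentMap hT v
      exact ⟨p, fun _ => hp⟩
    · exact ⟨id, fun h => absurd h hT⟩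
  choose p hp using hex
  have hp' : ∀ T ∈ Finset.univ.filter fun T : SimpleGraph V => T.Connected ∧ T.IsAcyclic,
      IsParentMap T v (p T) := fun T hT =>
    hp T ⟨(Finset.mem_filter.1 hT).2.1, (Finset.mem_filter.1 hT).2.2⟩
  have hW : ∀ T ∈ Finset.univ.filter fun T : SimpleGraph V => T.Connected ∧ T.IsAcyclic,
      ballWeight h R T v ≤ levelWeight h R {v}ᶜ {v} (p T) := by
    intro T hT
    have hT' := (Finset.mem_filter.1 hT).2.1
    have hpT := hp' T hT
    have h1 := levelWeight_eq_prod h (p := p T) (d := T.dist v) (v := v) (by simp) hpT.2.2 R 0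
    have h2 : (Finset.univ.filter fun w => T.dist v w = 0) = {v} := by
      ext w; simp [hT'.dist_eq_zero_iff, eq_comm]
    have h3 : (Finset.univ.filter fun w => 0 < T.dist v w) = {v}ᶜ := by
      ext w; simp [Nat.pos_iff_ne_zero, hT'.dist_eq_zero_iff, eq_comm]
    rw [h2, h3] at h1
    rw [h1, ballWeight]
    simp only [zero_le, true_and, zero_add]
    refine Finset.prod_le_prod (fun u _ => by positivity) fun u _ => ?_
    have := hpT.deg_sub_one_le u
    gcongr
    norm_num
  refine (Finset.sum_le_sum hW).trans ?_
  rw [← Finset.sum_image (g := p) (f := fun f => levelWeight h R {v}ᶜ {v} f)]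
  · have h1 := sum_levelWeight_le hh R {v}ᶜ Finset.univ {v} (Finset.subset_univ _)
      (Finset.subset_univ _) disjoint_compl_left
    rw [Finset.card_compl, Finset.card_univ, Finset.card_singleton, pow_one] at h1
    refine le_trans (Finset.sum_le_sum_of_subset_of_nonneg ?_ fun f _ _ => ?_) h1
    · intro f hf
      obtain ⟨T, hT, rfl⟩ := Finset.mem_image.1 hf
      rw [mem_funsInto]
      refine ⟨fun _ _ => Finset.mem_univ _, fun w hw => ?_⟩
      obtain rfl : w = v := by simpa using hw
      exact (hp' T hT).2.1
    · exact levelWeight_nonneg hh _ _ _ _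
  · intro S hS T hT hST
    rw [← (hp' S hS).1, ← (hp' T hT).1, hST]

open Classical in
lemma card_filter_ballWeight_mul_le {h : ℝ} (hh : 0 ≤ h) (R : ℕ) (θ : ℝ) :
    ((Finset.univ.filter fun T : SimpleGraph V =>
      (T.Connected ∧ T.IsAcyclic) ∧ ∃ v, θ ≤ ballWeight h R T v).card : ℝ) * θ ≤
      Fintype.card V * ((Fintype.card V : ℝ) ^ (Fintype.card V - 1) * growth h R) := by
  have hnn : ∀ (T : SimpleGraph V) (v : V), 0 ≤ ballWeight h R T v :=
    fun T v => Finset.prod_nonneg fun u _ => by positivity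
  calc _ = ∑ T : SimpleGraph V with
          (T.Connected ∧ T.IsAcyclic) ∧ ∃ v, θ ≤ ballWeight h R T v, θ := by
        rw [Finset.sum_const, nsmul_eq_mul]
    _ ≤ ∑ T : SimpleGraph V with
          (T.Connected ∧ T.IsAcyclic) ∧ ∃ v, θ ≤ ballWeight h R T v, ∑ v, ballWeight h R T v := by
        refine Finset.sum_le_sum fun T hT => ?_
        obtain ⟨-, v, hv⟩ := (Finset.mem_filter.1 hT).2
        exact hv.trans (Finset.single_le_sum (f := fun v => ballWeight h R T v)
          (fun v _ => hnn T v) (Finset.mem_univ v))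
    _ ≤ ∑ T : SimpleGraph V with T.Connected ∧ T.IsAcyclic, ∑ v, ballWeight h R T v := by
        refine Finset.sum_le_sum_of_subset_of_nonneg
          (Finset.monotone_filter_right _ fun T _ hT => hT.1)
          fun T _ _ => Finset.sum_nonneg fun v _ => hnn T v
    _ = ∑ v, ∑ T : SimpleGraph V with T.Connected ∧ T.IsAcyclic, ballWeight h R T v :=
        Finset.sum_comm
    _ ≤ ∑ v : V, (Fintype.card V : ℝ) ^ (Fintype.card V - 1) * growth h R :=
        Finset.sum_le_sum fun v _ => sum_ballWeight_le hh R v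
    _ = _ := by rw [Finset.sum_const, Finset.card_univ, nsmul_eq_mul]

end Trees

section Asymptotics

lemma pow_card_le_ballWeight {V : Type} [Fintype V] {h κ : ℝ} (hh : 0 ≤ h) (hκ : 0 ≤ κ) {R : ℕ}
    {T : SimpleGraph V} {v : V} {S : Finset V}
    (hS : ∀ u ∈ S, T.dist v u < R ∧ κ ≤ 1 + h * 2 ^ (deg T u - 1)) :
    κ ^ S.card ≤ ballWeight h R T v := by
  classical
  have hsub : S ⊆ Finset.univ.filter fun u => T.dist v u < R := fun u hu => by simp [(hS u hu).1]
  rw [ballWeight, ← Finset.prod_sdiff hsub, ← Finset.prod_const]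
  have h1 : (1 : ℝ) ≤ ∏ u ∈ (Finset.univ.filter fun u => T.dist v u < R) \ S,
      (1 + h * 2 ^ (deg T u - 1)) := by
    refine Finset.prod_const_one.symm.le.trans
      (Finset.prod_le_prod (fun _ _ => zero_le_one' ℝ) fun u _ => ?_)
    exact le_add_of_nonneg_right (by positivity)
  have h2 : ∏ _u ∈ S, κ ≤ ∏ u ∈ S, (1 + h * 2 ^ (deg T u - 1)) :=
    Finset.prod_le_prod (fun _ _ => hκ) fun u hu => (hS u hu).2
  refine h2.trans (le_mul_of_one_le_left ?_ h1)
  exact Finset.prod_nonneg fun u _ => by positivity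

lemma exp_le_one_add_pow {ℓ R : ℝ} (hℓ : 1 ≤ ℓ) (hR : 1 ≤ R) (hRℓ : R ≤ 9 * ℓ) {N : ℕ}
    (hN : 10 ^ 8 * ℓ ^ 4 < N) : Real.exp (3 * ℓ) ≤ (1 + 1 / (84 * R ^ 2)) ^ N := by
  set h : ℝ := 1 / (84 * R ^ 2) with hh
  have hR2 : R ^ 2 ≤ 81 * ℓ ^ 2 := by nlinarith
  have hpos : 0 < h := by positivity
  have hhR : h * R ^ 2 = 1 / 84 := by rw [hh]; field_simp
  have hle : h ≤ 1 := by nlinarith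
  have h1 : h / 2 ≤ Real.log (1 + h) := by
    refine le_trans ?_ (Real.one_sub_inv_le_log_of_pos (by linarith))
    have : 1 - (1 + h)⁻¹ = h / (1 + h) := by field_simp; ring
    rw [this]
    exact div_le_div_of_nonneg_left hpos.le (by linarith) (by linarith)
  have h2 : (1 + h) ^ N = Real.exp (N * Real.log (1 + h)) := by
    rw [Real.exp_nat_mul, Real.exp_log (by linarith)]
  rw [h2, Real.exp_le_exp]
  have h3 : 1 / 6804 ≤ h * ℓ ^ 2 := by nlinarith
  calc 3 * ℓ ≤ 10 ^ 8 * ℓ ^ 2 * (1 / 6804) / 2 := by nlinarith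
    _ ≤ 10 ^ 8 * ℓ ^ 2 * (h * ℓ ^ 2) / 2 := by gcongr
    _ = 10 ^ 8 * ℓ ^ 4 * (h / 2) := by ring
    _ ≤ N * (h / 2) := by gcongr
    _ ≤ N * Real.log (1 + h) := by gcongr

lemma exp_le_mul_two_pow {ℓ R : ℝ} (hℓ : 1 ≤ ℓ) (hlog : 10 ≤ Real.log ℓ) (hR : 1 ≤ R)
    (hRℓ : R ≤ 9 * ℓ) {D : ℕ} (hD : Real.log ℓ ^ 5 < D) :
    Real.exp (3 * Real.log ℓ ^ 2) ≤ 1 / (84 * R ^ 2) * 2 ^ (D - 1) := by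
  set l := Real.log ℓ with hl
  have hℓe : ℓ = Real.exp l := (Real.exp_log (by linarith)).symm
  have hR2 : R ^ 2 ≤ 81 * ℓ ^ 2 := by nlinarith
  have h9 : (6804 : ℝ) ≤ Real.exp 9 := by
    have h1 : (2.7182818283 : ℝ) ^ 9 ≤ Real.exp 1 ^ 9 := by
      have := Real.exp_one_gt_d9
      gcongr
    rw [← Real.exp_nat_mul] at h1
    norm_num at h1 ⊢
    linarith
  have h2 : 84 * R ^ 2 ≤ Real.exp (9 + 2 * l) := by
    rw [Real.exp_add, two_mul, Real.exp_add, ← hℓe]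
    nlinarith [mul_nonneg (sub_nonneg.2 h9) (sq_nonneg ℓ)]
  have h3 : Real.exp ((l ^ 5 - 1) / 2) ≤ 2 ^ (D - 1) := by
    have h4 : (2 : ℝ) ^ (D - 1) = Real.exp ((D - 1 : ℕ) * Real.log 2) := by
      rw [Real.exp_nat_mul, Real.exp_log (by norm_num)]
    have h5 : (D : ℝ) - 1 ≤ (D - 1 : ℕ) := by
      have : D ≤ (D - 1) + 1 := by omega
      have : (D : ℝ) ≤ (D - 1 : ℕ) + 1 := by exact_mod_cast this
      linarith
    rw [h4, Real.exp_le_exp]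
    have h6 := Real.log_two_gt_d9
    have h7 : 0 ≤ l ^ 5 - 1 := by
      have := one_le_pow₀ (n := 5) (by linarith : 1 ≤ l)
      linarith
    calc (l ^ 5 - 1) / 2 = (l ^ 5 - 1) * (1 / 2) := by ring
      _ ≤ (D - 1 : ℕ) * Real.log 2 := by
        refine mul_le_mul ?_ ?_ ?_ ?_ <;> linarith
  calc Real.exp (3 * l ^ 2) ≤ Real.exp ((l ^ 5 - 1) / 2 - (9 + 2 * l)) := by
        rw [Real.exp_le_exp]
        have h8 : 1000 * l ^ 2 ≤ l ^ 5 := by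
          have : (10 : ℝ) ^ 3 ≤ l ^ 3 := by gcongr
          nlinarith [mul_nonneg (sub_nonneg.2 this) (sq_nonneg l)]
        nlinarith
    _ = 1 / Real.exp (9 + 2 * l) * Real.exp ((l ^ 5 - 1) / 2) := by
        rw [Real.exp_sub]; ring
    _ ≤ _ := by gcongr

lemma exists_le_ballWeight {n : ℕ} (hloglog : 10 ≤ Real.log (Real.log n)) {T : SimpleGraph (Fin n)}
    (hT : ¬ ∀ v : Fin n,
      (Nat.card {w : Fin n // T.dist v w ≤ r0 n} : ℝ) ≤ 10 ^ 8 * Real.log n ^ 4 ∧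
      (Nat.card {w : Fin n // T.dist v w ≤ r0 n ∧
          (Real.log (Real.log n)) ^ 5 < (deg T w : ℝ)} : ℝ) <
        Real.log n / (Real.log (Real.log n)) ^ 2) :
    ∃ v, (n : ℝ) ^ 3 ≤ ballWeight (1 / (84 * ((r0 n + 1 : ℕ) : ℝ) ^ 2)) (r0 n + 1) T v := by
  classical
  set ℓ := Real.log n with hℓ
  have hn0 : n ≠ 0 := by
    rintro rfl
    simp [hℓ] at hloglog
    linarith
  have hn : (0 : ℝ) < n := by exact_mod_cast Nat.pos_of_ne_zero hn0
  have hℓ0 : 0 ≤ ℓ := Real.log_natCast_nonneg n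
  have hℓ1 : 1 ≤ ℓ := by
    by_contra h
    have := Real.log_nonpos hℓ0 (not_le.1 h).le
    linarith
  have hℓ2 : 2 ≤ ℓ := by
    have h1 : Real.log ℓ ≤ ℓ - 1 := Real.log_le_sub_one_of_pos (by linarith)
    linarith
  have hn3 : (n : ℝ) ^ 3 = Real.exp (3 * ℓ) := by
    rw [← Real.exp_log hn, ← Real.exp_nat_mul]; simp [hℓ]
  set R : ℝ := ((r0 n + 1 : ℕ) : ℝ) with hR
  have hR1 : 1 ≤ R := by rw [hR]; push_cast; linarith [(r0 n).cast_nonneg (α := ℝ)]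
  have hRℓ : R ≤ 9 * ℓ := by
    have h1 := Nat.ceil_lt_add_one (a := 7 * Real.log n) (by positivity)
    rw [hR, r0]; push_cast; linarith
  have hh : 0 ≤ 1 / (84 * R ^ 2) := by positivity
  push Not at hT
  obtain ⟨v, hv⟩ := hT
  refine ⟨v, ?_⟩
  rw [hn3]
  by_cases hball : (Nat.card {w : Fin n // T.dist v w ≤ r0 n} : ℝ) ≤ 10 ^ 8 * ℓ ^ 4
  · have hv := hv hball
    rw [Nat.card_eq_fintype_card, Fintype.card_subtype] at hv
    set S := Finset.univ.filter fun w => T.dist v w ≤ r0 n ∧ Real.log ℓ ^ 5 < (deg T w : ℝ)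
    have h1 := pow_card_le_ballWeight (S := S) (T := T) (v := v) (R := r0 n + 1) hh
      (Real.exp_nonneg (3 * Real.log ℓ ^ 2)) (fun u hu => by
        have hu := (Finset.mem_filter.1 hu).2
        refine ⟨by omega, ?_⟩
        have := exp_le_mul_two_pow hℓ1 hloglog hR1 hRℓ hu.2
        linarith)
    refine le_trans ?_ h1
    rw [← Real.exp_nat_mul, Real.exp_le_exp]
    have h2 : 0 < Real.log ℓ ^ 2 := by positivity
    rw [div_le_iff₀ h2] at hv
    linarith
  · rw [not_le, Nat.card_eq_fintype_card, Fintype.card_subtype] at hball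
    refine (exp_le_one_add_pow hℓ1 hR1 hRℓ hball).trans ?_
    refine pow_card_le_ballWeight hh (by positivity) fun u hu => ?_
    have hu := (Finset.mem_filter.1 hu).2
    refine ⟨by omega, ?_⟩
    have : (1 : ℝ) ≤ 2 ^ (deg T u - 1) := one_le_pow₀ (by norm_num)
    gcongr
    exact le_mul_of_one_le_right hh this

lemma treeProb_le_one (n : ℕ) (E : Set (SimpleGraph (Fin n))) : treeProb n E ≤ 1 := by
  classical
  refine div_le_one_of_le₀ ?_ (Nat.cast_nonneg _)
  exact_mod_cast Finset.card_le_card fun T hT => by simp_all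

lemma one_sub_le_treeProb {n R : ℕ} (hn : 0 < n) (hR : 0 < R) {E : Set (SimpleGraph (Fin n))}
    (hE : ∀ T ∉ E, ∃ v, (n : ℝ) ^ 3 ≤ ballWeight (1 / (84 * (R : ℝ) ^ 2)) R T v) :
    1 - 2 / (n : ℝ) ≤ treeProb n E := by
  classical
  have : Nonempty (Fin n) := ⟨⟨0, hn⟩⟩
  have hn' : (0 : ℝ) < n := by exact_mod_cast hn
  have hlow := pow_card_sub_one_le_card_trees (V := Fin n)
  have hup := card_filter_ballWeight_mul_le (V := Fin n) (h := 1 / (84 * (R : ℝ) ^ 2))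
    (by positivity) R ((n : ℝ) ^ 3)
  rw [Fintype.card_fin] at hlow hup
  have hsplit : (Finset.univ.filter
        fun T : SimpleGraph (Fin n) => T.Connected ∧ T.IsAcyclic).card ≤
      (Finset.univ.filter
        fun T : SimpleGraph (Fin n) => T.Connected ∧ T.IsAcyclic ∧ T ∈ E).card +
      (Finset.univ.filter fun T : SimpleGraph (Fin n) => (T.Connected ∧ T.IsAcyclic) ∧
        ∃ v, (n : ℝ) ^ 3 ≤ ballWeight (1 / (84 * (R : ℝ) ^ 2)) R T v).card := by
    refine le_trans (Finset.card_le_card fun T hT => ?_) (Finset.card_union_le _ _)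
    have hT := (Finset.mem_filter.1 hT).2
    by_cases hTE : T ∈ E
    · exact Finset.mem_union_left _ (by simp [hT, hTE])
    · exact Finset.mem_union_right _ (by simpa [hT] using hE T hTE)
  rw [treeProb]
  set N := (Finset.univ.filter
    fun T : SimpleGraph (Fin n) => T.Connected ∧ T.IsAcyclic).card
  set G := (Finset.univ.filter
    fun T : SimpleGraph (Fin n) => T.Connected ∧ T.IsAcyclic ∧ T ∈ E).card
  set b := (Finset.univ.filter fun T : SimpleGraph (Fin n) => (T.Connected ∧ T.IsAcyclic) ∧
    ∃ v, (n : ℝ) ^ 3 ≤ ballWeight (1 / (84 * (R : ℝ) ^ 2)) R T v).card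
  have hup' : (b : ℝ) * (n : ℝ) ^ 3 ≤
      n * ((n : ℝ) ^ (n - 1) * growth (1 / (84 * (R : ℝ) ^ 2)) R) := by
    convert hup
  have hlow' : (n : ℝ) ^ (n - 1) ≤ N * n := by exact_mod_cast hlow
  have hsplit' : (N : ℝ) ≤ G + b := by exact_mod_cast hsplit
  have hNpos : (0 : ℝ) < N := by
    have : (0 : ℝ) < N * n := lt_of_lt_of_le (by positivity) hlow'
    exact pos_of_mul_pos_left this hn'.le
  have hg := growth_le hR le_rfl
  have hb1 : (b : ℝ) * n ^ 3 ≤ n * (N * n * 2) := by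
    refine hup'.trans (mul_le_mul_of_nonneg_left ?_ hn'.le)
    exact mul_le_mul hlow' hg (zero_le_one.trans (one_le_growth (by positivity) R)) (by positivity)
  have hb2 : (b : ℝ) * n ≤ 2 * N := by
    refine le_of_mul_le_mul_right ?_ (by positivity : (0 : ℝ) < (n : ℝ) ^ 2)
    calc (b : ℝ) * n * (n : ℝ) ^ 2 = b * n ^ 3 := by ring
      _ ≤ (n : ℝ) * (N * n * 2) := hb1
      _ = 2 * N * (n : ℝ) ^ 2 := by ring
  rw [le_div_iff₀ hNpos]
  have hb3 : (b : ℝ) ≤ 2 / n * N := by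
    rw [div_mul_eq_mul_div, le_div_iff₀ hn']
    exact hb2
  linarith

end Asymptotics

end FODef

theorem statement19 :
    Tendsto (fun n : ℕ => treeProb n
        {T | ∀ v : Fin n,
          (Nat.card {w : Fin n // T.dist v w ≤ r0 n} : ℝ) ≤ 10 ^ 8 * Real.log n ^ 4 ∧
          (Nat.card {w : Fin n // T.dist v w ≤ r0 n ∧
              (Real.log (Real.log n)) ^ 5 < (deg T w : ℝ)} : ℝ) <
            Real.log n / (Real.log (Real.log n)) ^ 2})
      atTop (nhds 1) := by
  have hlim : Tendsto (fun n : ℕ => 1 - 2 / (n : ℝ)) atTop (nhds 1) := by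
    simpa using (tendsto_const_nhds (x := (1 : ℝ))).sub (tendsto_const_div_atTop_nhds_zero_nat 2)
  have hloglog : Tendsto (fun n : ℕ => Real.log (Real.log n)) atTop atTop :=
    Real.tendsto_log_atTop.comp (Real.tendsto_log_atTop.comp tendsto_natCast_atTop_atTop)
  refine tendsto_of_tendsto_of_tendsto_of_le_of_le' hlim tendsto_const_nhds ?_
    (Eventually.of_forall fun n => treeProb_le_one n _)
  filter_upwards [hloglog.eventually_ge_atTop 10, eventually_gt_atTop 0] with n hn hn0
  exact one_sub_le_treeProb hn0 (Nat.succ_pos (r0 n)) fun T hT => exists_le_ballWeight hn hT
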